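/- Let C be an Ext-finite hereditary abelian category with a Serre functor. Let Q be the full subcategory of C whose objects are quotients of preprojective objects. Then Q is closed under subobjects, quotients, and extensions; in particular Q is an abelian (exact-embedded) subcategory of C. -/

import Mathlib

open CategoryTheory CategoryTheory.Limits CategoryTheory.Pretriangulated

attribute [local instance] CategoryTheory.Abelian.hasFiniteBiproducts

/-- A right Serre functor: an additive endofunctor `F` with isomorphisms
`Hom(X,Y) ≅ Hom(Y,FX)*` natural in both variables. -/
structure RightSerreFunctor (k : Type) [Field k] (A : Type) [Category A]
    [Preadditive A] [Linear k A] where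
  F : A ⥤ A
  additive : F.Additive
  η : ∀ X Y : A, (X ⟶ Y) ≃ₗ[k] Module.Dual k (Y ⟶ F.obj X)
  nat_left : ∀ {X X' Y : A} (f : X' ⟶ X) (h : X ⟶ Y) (g : Y ⟶ F.obj X'),
    η X' Y (f ≫ h) g = η X Y h (g ≫ F.map f)
  nat_right : ∀ {X Y Y' : A} (h : X ⟶ Y) (g : Y ⟶ Y') (g' : Y' ⟶ F.obj X),
    η X Y' (h ≫ g) g' = η X Y h (g ≫ g')

/-- `ι : C ⥤ T` realizes `T` as a model of the bounded derived category `D^b(C)`: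
negative-degree morphisms out of the heart vanish, short exact sequences of `C` give
distinguished triangles, and every object of `T` is a finite direct sum of shifts of
objects of `C`. -/
def IsBoundedDerivedModel {C T : Type} [Category C] [Abelian C] [Category T]
    [Preadditive T] [HasZeroObject T] [HasFiniteBiproducts T] [HasShift T ℤ]
    [∀ n : ℤ, (CategoryTheory.shiftFunctor T n).Additive] [Pretriangulated T]
    (ι : C ⥤ T) : Prop :=
  (∀ (A B : C) (n : ℤ), n < 0 → ∀ f : ι.obj A ⟶ (ι.obj B)⟦n⟧, f = 0) ∧
  (∀ S : ShortComplex C, S.ShortExact →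
    ∃ δ : ι.obj S.X₃ ⟶ (ι.obj S.X₁)⟦(1 : ℤ)⟧,
      Triangle.mk (ι.map S.f) (ι.map S.g) δ ∈ distTriang T) ∧
  (∀ X : T, ∃ (n : ℕ) (obj : Fin n → C) (deg : Fin n → ℤ),
    Nonempty (X ≅ ⨁ fun i => (ι.obj (obj i))⟦deg i⟧))

/-- An object is indecomposable if it is nonzero and has no nontrivial idempotent
endomorphisms. -/
def Indec {C : Type} [Category C] [Limits.HasZeroMorphisms C] (X : C) : Prop :=
  ¬ Limits.IsZero X ∧ ∀ e : X ⟶ X, e ≫ e = e → e = 0 ∨ e = 𝟙 X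

/-- A short exact sequence `0 → X₁ → X₂ → X₃ → 0` is almost split if it does not split,
its end terms are indecomposable, and every map to `X₃` which is not a split
epimorphism factors through `X₂ → X₃`. -/
def IsAlmostSplitSeq {C : Type} [Category C] [Abelian C] (S : ShortComplex C) : Prop :=
  S.ShortExact ∧ (¬ ∃ s : S.X₃ ⟶ S.X₂, s ≫ S.g = 𝟙 S.X₃) ∧
  Indec S.X₁ ∧ Indec S.X₃ ∧
  ∀ (X : C) (t : X ⟶ S.X₃), ¬ IsSplitEpi t → ∃ u : X ⟶ S.X₂, u ≫ S.g = t

/-- `Y ≅ τ⁻¹ X`: there is an almost split sequence `0 → X → E → Y → 0`. -/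
def TauInvStep {C : Type} [Category C] [Abelian C] (X Y : C) : Prop :=
  ∃ S : ShortComplex C, IsAlmostSplitSeq S ∧ Nonempty (S.X₁ ≅ X) ∧ Nonempty (S.X₃ ≅ Y)

/-- `X ≅ τ^{-a} P`: a chain of `a` almost split sequences starting at `P`. -/
def TauInvChain {C : Type} [Category C] [Abelian C] (P X : C) (a : ℕ) : Prop :=
  ∃ ch : ℕ → C, Nonempty (ch 0 ≅ P) ∧ Nonempty (ch a ≅ X) ∧
    ∀ i < a, TauInvStep (ch i) (ch (i + 1))

/-- An object is preprojective if it is a finite direct sum of objects of the form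
`τ^{-a} P` with `P` indecomposable projective and `a ≥ 0`. -/
def Preprojective {C : Type} [Category C] [Abelian C] (X : C) : Prop :=
  ∃ (n : ℕ) (obj : Fin n → C),
    (∀ i, ∃ (P : C) (a : ℕ), Projective P ∧ Indec P ∧ TauInvChain P (obj i) a) ∧
    Nonempty (X ≅ ⨁ obj)

/-- An object lies in `𝒬` if it is a quotient of a preprojective object. -/
def IsQuotientOfPreprojective {C : Type} [Category C] [Abelian C] (X : C) : Prop :=
  ∃ (R : C) (p : R ⟶ X), Preprojective R ∧ Epi p

section Indecomposable

variable {A B : Type} [Category A] [Category B] [Preadditive A] [Preadditive B]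

lemma indec_map_iff (G : A ⥤ B) [G.Full] [G.Faithful] [G.Additive] (X : A) :
    Indec (G.obj X) ↔ Indec X := by
  have hz : IsZero (G.obj X) ↔ IsZero X := by
    rw [IsZero.iff_id_eq_zero, IsZero.iff_id_eq_zero, ← G.map_id, G.map_eq_zero_iff]
  unfold Indec
  rw [hz]
  refine and_congr_right fun _ => ⟨fun h e he => ?_, fun h e he => ?_⟩
  · refine (h (G.map e) (by rw [← G.map_comp, he])).imp (fun h => ?_) (fun h => ?_)
    · exact (G.map_eq_zero_iff).1 h
    · exact G.map_injective (by rw [h, G.map_id])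
  · obtain ⟨e, rfl⟩ := G.map_surjective e
    refine (h e (G.map_injective (by rw [G.map_comp, he]))).imp (fun h => ?_) (fun h => ?_)
    · rw [h, G.map_zero]
    · rw [h, G.map_id]

lemma Indec.of_iso {X Y : A} (h : Indec X) (i : X ≅ Y) : Indec Y := by
  refine ⟨fun hY => h.1 (hY.of_iso i), fun e he => ?_⟩
  have := h.2 (i.hom ≫ e ≫ i.inv) (by simp [reassoc_of% he])
  refine this.imp (fun h => ?_) (fun h => ?_)
  · simpa using congrArg (fun t => i.inv ≫ t ≫ i.hom) h
  · simpa using congrArg (fun t => i.inv ≫ t ≫ i.hom) h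

lemma Indec.isIso_of_comp_eq_id {X Y : A} (hY : Indec Y) (hX : ¬ IsZero X)
    {i : X ⟶ Y} {r : Y ⟶ X} (h : i ≫ r = 𝟙 X) : IsIso i ∧ IsIso r := by
  have : r ≫ i = 𝟙 Y := by
    refine (hY.2 (r ≫ i) (by simp [reassoc_of% h])).resolve_left fun h0 => hX ?_
    have h1 : 𝟙 X = i ≫ (r ≫ i) ≫ r := by simp [h]
    rw [IsZero.iff_id_eq_zero, h1, h0, zero_comp, comp_zero]
  exact ⟨⟨r, h, this⟩, ⟨i, this, h⟩⟩

lemma Indec.exists_iso_of_biproduct [HasFiniteBiproducts A] {X : A} (h : Indec X) {n : ℕ}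
    {f : Fin n → A} (i : X ≅ ⨁ f) : ∃ j, Nonempty (X ≅ f j) := by
  have hX := h.of_iso i
  by_contra! hc
  refine hX.1 ((IsZero.iff_id_eq_zero _).2 ?_)
  rw [← biproduct.total]
  refine Finset.sum_eq_zero fun j _ => ?_
  refine (hX.2 (biproduct.π f j ≫ biproduct.ι f j) (by simp)).resolve_right fun h1 => ?_
  exact (hc j).false (i ≪≫ ⟨biproduct.π f j, biproduct.ι f j, h1, by simp⟩)

/-- **Fitting's lemma** for indecomposable objects with finite dimensional endomorphism algebra. -/
lemma Indec.isIso_or_nilpotent (k : Type) [Field k] [Linear k A] {X : A} (h : Indec X)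
    [FiniteDimensional k (X ⟶ X)] (f : X ⟶ X) :
    IsIso f ∨ ∃ n : ℕ, (End.of f) ^ n = 0 := by
  let L : Module.End k (X ⟶ X) := Linear.rightComp k X f
  have hL : ∀ (n : ℕ) (g : X ⟶ X), (L ^ n) g = g ≫ End.asHom (End.of f ^ n) := by
    intro n
    induction n with
    | zero => intro g; simp [End.one_def]
    | succ n ih =>
      intro g
      rw [pow_succ, Module.End.mul_apply, ih, pow_succ]
      simp [L, End.mul_def]
  obtain ⟨n, hn, hc⟩ := ((Filter.eventually_ge_atTop 1).and
    L.eventually_isCompl_ker_pow_range_pow).exists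
  obtain ⟨a, ha, b, hb, hab⟩ := Submodule.mem_sup.1
    (show 𝟙 X ∈ LinearMap.ker (L ^ n) ⊔ LinearMap.range (L ^ n) by simp [hc.sup_eq_top])
  have ha' : (L ^ n) a = 0 := ha
  have h1 : a ≫ b = 0 := by
    have e : a ≫ b = a - a ≫ a := by
      rw [eq_sub_iff_add_eq, ← Preadditive.comp_add, add_comm, hab, Category.comp_id]
    refine (Submodule.disjoint_def.1 hc.disjoint) _ ?_ ?_
    · rw [e]
      refine Submodule.sub_mem _ ha ?_
      rw [LinearMap.mem_ker, hL, Category.assoc, ← hL, ha', comp_zero]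
    · obtain ⟨c, rfl⟩ := hb
      exact ⟨a ≫ c, by rw [hL, hL, Category.assoc]⟩
  have h2 : b ≫ b = b := by
    have := congrArg (· ≫ b) hab
    simpa [Preadditive.add_comp, h1] using this
  rcases h.2 b h2 with hb0 | hb1
  · right
    refine ⟨n, ?_⟩
    have : a = 𝟙 X := by simpa [hb0] using hab
    rw [hL, this, Category.id_comp] at ha'
    exact ha'
  · left
    obtain ⟨c, hc⟩ := hb
    obtain ⟨m, rfl⟩ : ∃ m, n = m + 1 := ⟨n - 1, by omega⟩
    rw [hL, hb1, pow_succ'] at hc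
    exact (h.isIso_of_comp_eq_id h.1 (i := c ≫ End.asHom (End.of f ^ m)) (r := f)
      (by simpa [End.mul_def] using hc)).2

end Indecomposable

section Linear

variable (k : Type) [Field k]

lemma Indec.isIso_right_of_isIso_add {A : Type} [Category A] [Preadditive A] [Linear k A] {X : A}
    (h : Indec X) [FiniteDimensional k (X ⟶ X)] {f g : X ⟶ X} (hf : ¬ IsIso f)
    (hfg : IsIso (f + g)) : IsIso g := by
  have hf' : ¬ IsIso (inv (f + g) ≫ f) := fun hi => hf <| by
    have : f = (f + g) ≫ (inv (f + g) ≫ f) := by simp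
    rw [this]; infer_instance
  obtain ⟨n, hn⟩ := (h.isIso_or_nilpotent k (inv (f + g) ≫ f)).resolve_left hf'
  have hu : IsUnit (1 - End.of (inv (f + g) ≫ f)) := IsNilpotent.isUnit_one_sub ⟨n, hn⟩
  have hgi : inv (f + g) ≫ g = 𝟙 X - inv (f + g) ≫ f := by
    rw [eq_sub_iff_add_eq, ← Preadditive.comp_add, add_comm g f, IsIso.inv_hom_id]
  have : IsIso (inv (f + g) ≫ g) := by
    rw [hgi]
    exact (isUnit_iff_isIso _).1 hu
  exact IsIso.of_isIso_comp_left (inv (f + g)) g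

lemma Indec.exists_dual_vanishing_on_nonIso {A : Type} [Category A] [Preadditive A] [Linear k A]
    {X : A} (h : Indec X) [FiniteDimensional k (X ⟶ X)] :
    ∃ φ : Module.Dual k (X ⟶ X), φ (𝟙 X) ≠ 0 ∧ ∀ f, ¬ IsIso f → φ f = 0 := by
  have h0 : ¬ IsIso (0 : X ⟶ X) := fun _ => h.1 <| by
    rw [IsZero.iff_id_eq_zero, ← IsIso.hom_inv_id (0 : X ⟶ X), zero_comp]
  let J : Submodule k (X ⟶ X) :=
    { carrier := {f | ¬ IsIso f}
      add_mem' := fun {f g} hf hg hfg => hg (h.isIso_right_of_isIso_add k hf hfg)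
      zero_mem' := h0
      smul_mem' := fun c f hf hcf => hf <| by
        have hc : c ≠ 0 := by
          rintro rfl
          rw [zero_smul] at hcf
          exact h0 hcf
        refine ⟨c • inv (c • f), ?_, ?_⟩
        · rw [Linear.comp_smul, ← Linear.smul_comp, IsIso.hom_inv_id]
        · rw [Linear.smul_comp, ← Linear.comp_smul, IsIso.inv_hom_id] }
  obtain ⟨φ, h1, hJ⟩ := Submodule.exists_le_ker_of_notMem
    (show 𝟙 X ∉ J from fun hn => hn inferInstance)
  exact ⟨φ, h1, fun f hf => hJ (show f ∈ J from hf)⟩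

/-- The linear structure pulled back along a fully faithful additive functor. -/
noncomputable abbrev inducedLinear {A B : Type} [Category A] [Category B] [Preadditive A]
    [Preadditive B] [Linear k B] (G : A ⥤ B) [G.Full] [G.Faithful] [G.Additive] :
    Linear k A where
  homModule X Y :=
    { smul := fun r f => G.preimage (r • G.map f)
      one_smul := fun f => G.map_injective (by
        change G.map (G.preimage _) = _
        simp)
      mul_smul := fun r s f => G.map_injective (by
        change G.map (G.preimage _) = G.map (G.preimage (_ • G.map (G.preimage _)))
        simp [mul_smul])
      smul_zero := fun r => G.map_injective (by
        change G.map (G.preimage _) = _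
        simp)
      zero_smul := fun f => G.map_injective (by
        change G.map (G.preimage _) = _
        simp)
      smul_add := fun r f g => G.map_injective (by
        change G.map (G.preimage _) = G.map (G.preimage _ + G.preimage _)
        simp)
      add_smul := fun r s f => G.map_injective (by
        change G.map (G.preimage _) = G.map (G.preimage _ + G.preimage _)
        simp [add_smul]) }
  smul_comp X Y Z r f g := G.map_injective (by
    change G.map (G.preimage _ ≫ _) = G.map (G.preimage _)
    simp)
  comp_smul X Y Z f r g := G.map_injective (by
    change G.map (_ ≫ G.preimage _) = G.map (G.preimage _)
    simp)

lemma finiteDimensional_inducedLinear {A B : Type} [Category A] [Category B] [Preadditive A]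
    [Preadditive B] [Linear k B] (G : A ⥤ B) [G.Full] [G.Faithful] [G.Additive]
    (hfin : ∀ X Y : B, FiniteDimensional k (X ⟶ Y)) (X Y : A) :
    letI := inducedLinear k G
    FiniteDimensional k (X ⟶ Y) := by
  let := inducedLinear k G
  have := hfin (G.obj X) (G.obj Y)
  let L : (X ⟶ Y) →ₗ[k] (G.obj X ⟶ G.obj Y) :=
    { toFun := fun f => G.map f
      map_add' := fun f g => G.map_add
      map_smul' := fun r f => by
        change G.map (G.preimage _) = _
        simp }
  exact FiniteDimensional.of_injective L G.map_injective

end Linear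

section Decomposition

variable {C : Type} [Category C] [Abelian C]

lemma exists_biproduct_of_biprod {p : C → Prop} {X Y : C}
    (hX : ∃ (n : ℕ) (f : Fin n → C), (∀ i, p (f i)) ∧ Nonempty (X ≅ ⨁ f))
    (hY : ∃ (n : ℕ) (f : Fin n → C), (∀ i, p (f i)) ∧ Nonempty (Y ≅ ⨁ f)) :
    ∃ (n : ℕ) (f : Fin n → C), (∀ i, p (f i)) ∧ Nonempty (X ⊞ Y ≅ ⨁ f) := by
  obtain ⟨m, f, hf, ⟨eX⟩⟩ := hX
  obtain ⟨n, g, hg, ⟨eY⟩⟩ := hY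
  let F : Fin m ⊕ Fin n → C := Sum.elim f g
  let inl : ∀ i, f i ⟶ ⨁ F := fun i => biproduct.ι F (Sum.inl i)
  let inr : ∀ i, g i ⟶ ⨁ F := fun i => biproduct.ι F (Sum.inr i)
  let d : ∀ s, F s ⟶ (⨁ f) ⊞ (⨁ g)
    | Sum.inl i => biproduct.ι f i ≫ biprod.inl
    | Sum.inr i => biproduct.ι g i ≫ biprod.inr
  have hinl : ∀ i, inl i ≫ biproduct.desc d = biproduct.ι f i ≫ biprod.inl :=
    fun i => biproduct.ι_desc d (Sum.inl i)
  have hinr : ∀ i, inr i ≫ biproduct.desc d = biproduct.ι g i ≫ biprod.inr :=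
    fun i => biproduct.ι_desc d (Sum.inr i)
  let e : (⨁ f) ⊞ (⨁ g) ≅ ⨁ F :=
    { hom := biprod.desc (biproduct.desc inl) (biproduct.desc inr)
      inv := biproduct.desc d
      hom_inv_id := by
        refine biprod.hom_ext' _ _ (biproduct.hom_ext' _ _ fun i => ?_)
          (biproduct.hom_ext' _ _ fun i => ?_)
        · simp [hinl]
        · simp [hinr]
      inv_hom_id := biproduct.hom_ext' _ _ fun s => by
        rw [biproduct.ι_desc_assoc, Category.comp_id]
        cases s with
        | inl i =>
          change (biproduct.ι f i ≫ biprod.inl) ≫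
            biprod.desc (biproduct.desc inl) (biproduct.desc inr) = inl i
          simp
        | inr i =>
          change (biproduct.ι g i ≫ biprod.inr) ≫
            biprod.desc (biproduct.desc inl) (biproduct.desc inr) = inr i
          simp }
  refine ⟨m + n, F ∘ finSumFinEquiv.symm, fun i => ?_, ⟨biprod.mapIso eX eY ≪≫ e ≪≫
    biproduct.whiskerEquiv finSumFinEquiv fun j => eqToIso (by simp)⟩⟩
  obtain ⟨s, rfl⟩ := finSumFinEquiv.surjective i
  cases s with
  | inl i => simpa [F] using hf i
  | inr i => simpa [F] using hg i

lemma exists_biproduct_singleton {p : C → Prop} {X : C} (hX : p X) :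
    ∃ (n : ℕ) (f : Fin n → C), (∀ i, p (f i)) ∧ Nonempty (X ≅ ⨁ f) :=
  ⟨1, fun _ => X, fun _ => hX, ⟨(biproductUniqueIso fun _ : Fin 1 => X).symm⟩⟩

lemma exists_biproduct_of_isZero {p : C → Prop} {X : C} (hX : IsZero X) :
    ∃ (n : ℕ) (f : Fin n → C), (∀ i, p (f i)) ∧ Nonempty (X ≅ ⨁ f) := by
  refine ⟨0, Fin.elim0, fun i => i.elim0, ⟨hX.iso ?_⟩⟩
  rw [IsZero.iff_id_eq_zero]
  exact biproduct.hom_ext _ _ fun i => i.elim0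

lemma exists_biprod_of_idempotent {X : C} {e : X ⟶ X} (he : e ≫ e = e) :
    ∃ (Y Z : C) (_ : X ≅ Y ⊞ Z) (i : Y ⟶ X) (r : X ⟶ Y) (j : Z ⟶ X) (s : X ⟶ Z),
      i ≫ r = 𝟙 Y ∧ r ≫ i = e ∧ j ≫ s = 𝟙 Z ∧ s ≫ j = 𝟙 X - e := by
  obtain ⟨Y, i, r, h1, h2⟩ := IsIdempotentComplete.idempotents_split X e he
  obtain ⟨Z, j, s, h3, h4⟩ := IsIdempotentComplete.idempotents_split X (𝟙 X - e)
    (Idempotents.idem_of_id_sub_idem _ (by simpa using he))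
  have his : i ≫ s = 0 := by
    have := i ≫= h4 =≫ s
    simp [h3, ← h2, reassoc_of% h1] at this
    exact this
  have hjr : j ≫ r = 0 := by
    have := j ≫= h2 =≫ r
    have h5 : e = 𝟙 X - s ≫ j := by rw [h4]; abel
    simp [h1, h5, reassoc_of% h3] at this
    exact this
  refine ⟨Y, Z, ⟨biprod.lift r s, biprod.desc i j, ?_, ?_⟩, i, r, j, s, h1, h2, h3, h4⟩
  · rw [biprod.lift_desc, h2, h4]; abel
  · ext <;> simp [h1, h3, his, hjr]

lemma finrank_end_lt_of_retract (k : Type) [Field k] [Linear k C] {X Y : C}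
    [FiniteDimensional k (X ⟶ X)] {i : Y ⟶ X} {r : X ⟶ Y} (h : i ≫ r = 𝟙 Y)
    (hne : r ≫ i ≠ 𝟙 X) : Module.finrank k (Y ⟶ Y) < Module.finrank k (X ⟶ X) := by
  let L : (Y ⟶ Y) →ₗ[k] (X ⟶ X) := Linear.leftComp k X r ∘ₗ Linear.rightComp k Y i
  have hL : ∀ f, L f = r ≫ f ≫ i := fun f => rfl
  have hinj : Function.Injective L := fun f g hfg => by
    have := i ≫= hfg =≫ r
    simpa [hL, h, reassoc_of% h] using this
  rw [← LinearMap.finrank_range_of_inj hinj]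
  refine Submodule.finrank_lt fun htop => hne ?_
  obtain ⟨f, hf⟩ := (show 𝟙 X ∈ LinearMap.range L by rw [htop]; trivial)
  rw [hL] at hf
  calc r ≫ i = (r ≫ i) ≫ (r ≫ f ≫ i) := by rw [hf, Category.comp_id]
    _ = 𝟙 X := by rw [← hf]; simp [reassoc_of% h]

lemma exists_indec_decomposition (k : Type) [Field k] [Linear k C]
    (hfin : ∀ X Y : C, FiniteDimensional k (X ⟶ Y)) (X : C) :
    ∃ (n : ℕ) (f : Fin n → C), (∀ i, Indec (f i)) ∧ Nonempty (X ≅ ⨁ f) := by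
  induction hd : Module.finrank k (X ⟶ X) using Nat.strong_induction_on generalizing X with
  | _ d ih =>
    subst hd
    by_cases hz : IsZero X
    · exact exists_biproduct_of_isZero hz
    by_cases hX : Indec X
    · exact exists_biproduct_singleton hX
    have hX' : ∃ e : X ⟶ X, e ≫ e = e ∧ e ≠ 0 ∧ e ≠ 𝟙 X := by
      simpa [Indec, hz] using hX
    obtain ⟨e, he, h0, h1⟩ := hX'
    obtain ⟨Y, Z, eX, i, r, j, s, hY, hY', hZ, hZ'⟩ := exists_biprod_of_idempotent he
    obtain ⟨n, f, hf, ⟨ef⟩⟩ := exists_biproduct_of_biprod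
      (ih _ (finrank_end_lt_of_retract k hY (by rwa [hY'])) Y rfl)
      (ih _ (finrank_end_lt_of_retract k hZ (by simpa [hZ'] using h0)) Z rfl)
    exact ⟨n, f, hf, ⟨eX ≪≫ ef⟩⟩

end Decomposition

section AlmostSplit

variable {C : Type} [Category C] [Abelian C]

lemma TauInvStep.of_iso {X Y X' Y' : C} (h : TauInvStep X Y) (i : X ≅ X') (j : Y ≅ Y') :
    TauInvStep X' Y' := by
  obtain ⟨S, hS, ⟨e⟩, ⟨e'⟩⟩ := h
  exact ⟨S, hS, ⟨e ≪≫ i⟩, ⟨e' ≪≫ j⟩⟩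

lemma TauInvChain.succ {P X Y : C} {a : ℕ} (h : TauInvChain P X a) (hXY : TauInvStep X Y) :
    TauInvChain P Y (a + 1) := by
  obtain ⟨ch, ⟨e₀⟩, ⟨ea⟩, hch⟩ := h
  refine ⟨fun i => if i ≤ a then ch i else Y, ⟨eqToIso (by simp) ≪≫ e₀⟩,
    ⟨eqToIso (by simp)⟩, fun i hi => ?_⟩
  rcases Nat.lt_or_ge i a with hia | hia
  · simpa [hia.le, Nat.succ_le_of_lt hia] using hch i hia
  · obtain rfl : i = a := by omega
    simpa using hXY.of_iso ea.symm (Iso.refl _)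

lemma IsAlmostSplitSeq.exists_lift {S : ShortComplex C} (hS : IsAlmostSplitSeq S) {X : C}
    (t : X ⟶ S.X₃) (ht : ¬ ∃ s, s ≫ t = 𝟙 S.X₃) : ∃ u : X ⟶ S.X₂, u ≫ S.g = t :=
  hS.2.2.2.2 X t fun h => ht ⟨h.exists_splitEpi.some.section_, h.exists_splitEpi.some.id⟩

/-- The left end term of an almost split sequence is determined by the right one. -/
lemma IsAlmostSplitSeq.iso_left (hloc : ∀ X : C, Indec X → ∀ f : X ⟶ X,
      IsIso f ∨ ∃ n : ℕ, (End.of f) ^ n = 0)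
    {S S' : ShortComplex C} (hS : IsAlmostSplitSeq S) (hS' : IsAlmostSplitSeq S')
    (e : S.X₃ ≅ S'.X₃) : Nonempty (S.X₁ ≅ S'.X₁) := by
  have := hS.1.mono_f
  have := hS'.1.mono_f
  have := hS.1.epi_g
  obtain ⟨u, hu⟩ := hS'.exists_lift (S.g ≫ e.hom) fun ⟨s, hs⟩ => hS.2.1
    ⟨e.hom ≫ s, by simpa using e.hom ≫= hs =≫ e.inv⟩
  obtain ⟨v, hv⟩ := hS.exists_lift (S'.g ≫ e.inv) fun ⟨s, hs⟩ => hS'.2.1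
    ⟨e.inv ≫ s, by simpa using e.inv ≫= hs =≫ e.hom⟩
  obtain ⟨a, ha⟩ : ∃ a : S.X₁ ⟶ S'.X₁, a ≫ S'.f = S.f ≫ u :=
    ⟨hS'.1.exact.lift (S.f ≫ u) (by simp [hu]), hS'.1.exact.lift_f _ _⟩
  obtain ⟨b, hb⟩ : ∃ b : S'.X₁ ⟶ S.X₁, b ≫ S.f = S'.f ≫ v :=
    ⟨hS.1.exact.lift (S'.f ≫ v) (by simp [hv]), hS.1.exact.lift_f _ _⟩
  rcases hloc _ hS.2.2.1 (a ≫ b) with hi | ⟨n, hn⟩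
  · have := (hS'.2.2.1.isIso_of_comp_eq_id hS.2.2.1.1 (i := a) (r := b ≫ inv (a ≫ b))
      (by rw [← Category.assoc, IsIso.hom_inv_id])).1
    exact ⟨asIso a⟩
  · exfalso
    have hw : (u ≫ v) ≫ S.g = S.g := by simp [hv, reassoc_of% hu]
    have hpow : ∀ n : ℕ, ∃ w : S.X₂ ⟶ S.X₂, w ≫ S.g = S.g ∧
        S.f ≫ w = End.asHom (End.of (a ≫ b) ^ n) ≫ S.f := by
      intro n
      induction n with
      | zero => exact ⟨𝟙 _, by simp, by simp [End.one_def]⟩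
      | succ n ih =>
        obtain ⟨w, h1, h2⟩ := ih
        refine ⟨w ≫ u ≫ v, by rw [Category.assoc, hw, h1], ?_⟩
        rw [reassoc_of% h2, ← reassoc_of% ha, ← hb, pow_succ', End.mul_def]
        simp
    obtain ⟨w, h1, h2⟩ := hpow n
    rw [hn] at h2
    have h3 : S.f ≫ w = 0 := h2.trans zero_comp
    refine hS.2.1 ⟨hS.1.exact.desc w h3, ?_⟩
    rw [← cancel_epi S.g, ← Category.assoc, hS.1.exact.g_desc, h1, Category.comp_id]

end AlmostSplit

section Triangle

variable {T : Type} [Category T] [Preadditive T] [HasZeroObject T]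
  [HasShift T ℤ] [∀ n : ℤ, (CategoryTheory.shiftFunctor T n).Additive] [Pretriangulated T]
  {A E B X : T} {f : A ⟶ E} {g : E ⟶ B} {δ : B ⟶ A⟦(1 : ℤ)⟧}

lemma distTriang_lift₂ (hT : Triangle.mk f g δ ∈ distTriang T) (h : X ⟶ E) (hh : h ≫ g = 0) :
    ∃ c : X ⟶ A, h = c ≫ f :=
  Triangle.coyoneda_exact₂ _ hT h hh

lemma distTriang_lift₃ (hT : Triangle.mk f g δ ∈ distTriang T) (h : X ⟶ B) (hh : h ≫ δ = 0) :
    ∃ c : X ⟶ E, h = c ≫ g :=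
  Triangle.coyoneda_exact₃ _ hT h hh

lemma distTriang_lift₁ (hT : Triangle.mk f g δ ∈ distTriang T) (h : X ⟶ A) (hh : h ≫ f = 0) :
    ∃ (d : B⟦(-1 : ℤ)⟧ ⟶ A) (c : X ⟶ B⟦(-1 : ℤ)⟧), h = c ≫ d :=
  ⟨_, Triangle.coyoneda_exact₂ _ (inv_rot_of_distTriang _ hT) h hh⟩

lemma distTriang_desc₂ (hT : Triangle.mk f g δ ∈ distTriang T) (h : E ⟶ X) (hh : f ≫ h = 0) :
    ∃ c : B ⟶ X, h = g ≫ c :=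
  Triangle.yoneda_exact₂ _ hT h hh

lemma distTriang_desc₃ (hT : Triangle.mk f g δ ∈ distTriang T) (h : B ⟶ X) (hh : g ≫ h = 0) :
    ∃ c : A⟦(1 : ℤ)⟧ ⟶ X, h = δ ≫ c :=
  Triangle.yoneda_exact₃ _ hT h hh

lemma distTriang_desc₁ (hT : Triangle.mk f g δ ∈ distTriang T) (h : A ⟶ X)
    (hh : ∀ d : B⟦(-1 : ℤ)⟧ ⟶ X, d = 0) : ∃ c : E ⟶ X, h = f ≫ c :=
  Triangle.yoneda_exact₂ _ (inv_rot_of_distTriang _ hT) h (hh _)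

lemma distTriang_comp_zero₁₂ (hT : Triangle.mk f g δ ∈ distTriang T) : f ≫ g = 0 :=
  comp_distTriang_mor_zero₁₂ _ hT

lemma distTriang_comp_zero₂₃ (hT : Triangle.mk f g δ ∈ distTriang T) : g ≫ δ = 0 :=
  comp_distTriang_mor_zero₂₃ _ hT

lemma distTriang_of_iso₂ (hT : Triangle.mk f g δ ∈ distTriang T) (e : X ≅ E) :
    Triangle.mk (f ≫ e.inv) (e.hom ≫ g) δ ∈ distTriang T := by
  refine isomorphic_distinguished _ hT _ (Triangle.isoMk _ _ (Iso.refl _) e (Iso.refl _) ?_ ?_ ?_)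
  · change (f ≫ e.inv) ≫ e.hom = 𝟙 A ≫ f
    simp
  · change (e.hom ≫ g) ≫ 𝟙 B = e.hom ≫ g
    simp
  · change δ ≫ (𝟙 A)⟦(1 : ℤ)⟧' = 𝟙 B ≫ δ
    simp

lemma distTriang_morphism₂ {A' E' B' : T} {f' : A' ⟶ E'} {g' : E' ⟶ B'}
    {δ' : B' ⟶ A'⟦(1 : ℤ)⟧} (hT : Triangle.mk f g δ ∈ distTriang T)
    (hT' : Triangle.mk f' g' δ' ∈ distTriang T) (a : A ⟶ A') (c : B ⟶ B')
    (h : δ ≫ a⟦(1 : ℤ)⟧' = c ≫ δ') : ∃ b : E ⟶ E', f ≫ b = a ≫ f' ∧ g ≫ c = b ≫ g' :=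
  complete_distinguished_triangle_morphism₂ _ _ hT hT' a c h

end Triangle

section Shift

variable {C T : Type} [Category C] [Category T] [Preadditive T]
  [HasShift T ℤ] [∀ n : ℤ, (CategoryTheory.shiftFunctor T n).Additive] {ι : C ⥤ T}

lemma shift_hom_eq_zero (hvan : ∀ (A B : C) (n : ℤ), (n < 0 ∨ 2 ≤ n) →
      ∀ f : ι.obj A ⟶ (ι.obj B)⟦n⟧, f = 0)
    {A B : C} {m n : ℤ} (h : n < m ∨ m + 2 ≤ n) (f : (ι.obj A)⟦m⟧ ⟶ (ι.obj B)⟦n⟧) : f = 0 := by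
  let e : (ι.obj B)⟦n⟧ ≅ (ι.obj B)⟦n - m⟧⟦m⟧ :=
    (shiftFunctorAdd' T (n - m) m n (by omega)).app (ι.obj B)
  obtain ⟨g, hg⟩ := (CategoryTheory.shiftFunctor T m).map_surjective (f ≫ e.hom)
  rw [← cancel_mono e.hom, zero_comp, ← hg, hvan A B (n - m) (by omega) g, Functor.map_zero]

lemma shift_hom_obj_eq_zero (hvan : ∀ (A B : C) (n : ℤ), (n < 0 ∨ 2 ≤ n) →
      ∀ f : ι.obj A ⟶ (ι.obj B)⟦n⟧, f = 0)
    {A B : C} {m : ℤ} (h : 0 < m ∨ m + 2 ≤ 0) (f : (ι.obj A)⟦m⟧ ⟶ ι.obj B) : f = 0 := by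
  let e : ι.obj B ≅ (ι.obj B)⟦(0 : ℤ)⟧ := ((shiftFunctorZero T ℤ).app (ι.obj B)).symm
  rw [← cancel_mono e.hom, zero_comp]
  exact shift_hom_eq_zero hvan h _

end Shift

section Heart

variable {C T : Type} [Category C] [Abelian C] [Category T] [Preadditive T] [HasZeroObject T]
  [HasShift T ℤ] [∀ n : ℤ, (CategoryTheory.shiftFunctor T n).Additive] [Pretriangulated T]
  {ι : C ⥤ T}

/-- The essential image of `ι` is closed under extensions. -/
lemma exists_iso_of_extension [HasFiniteBiproducts T] [ι.Additive]
    (hmodel : IsBoundedDerivedModel ι)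
    (hvan : ∀ (A B : C) (n : ℤ), (n < 0 ∨ 2 ≤ n) → ∀ f : ι.obj A ⟶ (ι.obj B)⟦n⟧, f = 0)
    {A B : C} {E : T} {f : ι.obj A ⟶ E} {g : E ⟶ ι.obj B} {δ : ι.obj B ⟶ (ι.obj A)⟦(1 : ℤ)⟧}
    (hT : Triangle.mk f g δ ∈ distTriang T) : ∃ E' : C, Nonempty (ι.obj E' ≅ E) := by
  obtain ⟨n, obj, deg, ⟨e⟩⟩ := hmodel.2.2 E
  have hi : ∀ i, Nonempty (ι.obj (obj i) ≅ (ι.obj (obj i))⟦deg i⟧) := by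
    intro i
    let X : T := (ι.obj (obj i))⟦deg i⟧
    let a : X ⟶ E := biproduct.ι (fun i => (ι.obj (obj i))⟦deg i⟧) i ≫ e.inv
    let b : E ⟶ X := e.hom ≫ biproduct.π (fun i => (ι.obj (obj i))⟦deg i⟧) i
    have hab : a ≫ b = 𝟙 X := by simp [a, b, X]
    rcases eq_or_ne (deg i) 0 with hd | hd
    · rw [hd]
      exact ⟨((shiftFunctorZero T ℤ).app (ι.obj (obj i))).symm⟩
    have hX : IsZero X := by
      rw [IsZero.iff_id_eq_zero, ← hab]
      rcases lt_or_gt_of_ne hd with hd | hd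
      · obtain ⟨c, hc⟩ := distTriang_desc₂ hT b (hvan _ _ _ (Or.inl hd) _)
        have hc0 : c = 0 := hvan _ _ _ (Or.inl hd) c
        rw [hc, hc0, comp_zero, comp_zero]
      · obtain ⟨c, hc⟩ := distTriang_lift₂ hT a
          (shift_hom_obj_eq_zero hvan (Or.inl hd) _)
        have hc0 : c = 0 := shift_hom_obj_eq_zero hvan (Or.inl hd) c
        rw [hc, hc0, zero_comp, zero_comp]
    refine ⟨IsZero.iso ?_ hX⟩
    rw [IsZero.iff_id_eq_zero] at hX ⊢
    refine (CategoryTheory.shiftFunctor T (deg i)).map_injective ?_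
    rw [CategoryTheory.Functor.map_id, Functor.map_zero]
    exact hX
  exact ⟨⨁ obj, ⟨ι.mapBiproduct obj ≪≫ biproduct.mapIso (fun i => (hi i).some) ≪≫ e.symm⟩⟩

lemma exists_distTriang [HasFiniteBiproducts T] (hmodel : IsBoundedDerivedModel ι) {A E B : C}
    {f : A ⟶ E} {g : E ⟶ B} {w : f ≫ g = 0} (hS : (ShortComplex.mk f g w).ShortExact) :
    ∃ δ : ι.obj B ⟶ (ι.obj A)⟦(1 : ℤ)⟧, Triangle.mk (ι.map f) (ι.map g) δ ∈ distTriang T :=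
  hmodel.2.1 _ hS

lemma shortExact_of_distTriang [ι.Additive] [ι.Full] [ι.Faithful]
    (hvan : ∀ (A B : C) (n : ℤ), (n < 0 ∨ 2 ≤ n) → ∀ f : ι.obj A ⟶ (ι.obj B)⟦n⟧, f = 0)
    {A E B : C} {f : A ⟶ E} {g : E ⟶ B} {δ : ι.obj B ⟶ (ι.obj A)⟦(1 : ℤ)⟧}
    (hT : Triangle.mk (ι.map f) (ι.map g) δ ∈ distTriang T) :
    ∃ w : f ≫ g = 0, (ShortComplex.mk f g w).ShortExact := by
  have w : f ≫ g = 0 := ι.map_injective (by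
    rw [ι.map_comp, ι.map_zero]
    exact distTriang_comp_zero₁₂ hT)
  have hf : Mono f := (Preadditive.mono_iff_cancel_zero _).2 fun Z h hh => by
    refine ι.map_injective ?_
    obtain ⟨d, c, hc⟩ := distTriang_lift₁ hT (ι.map h) (by rw [← ι.map_comp, hh, ι.map_zero])
    have hc0 : c = 0 := hvan Z B (-1) (by omega) c
    rw [hc, hc0, zero_comp, ι.map_zero]
  have hg : Epi g := (Preadditive.epi_iff_cancel_zero _).2 fun Z h hh => by
    refine ι.map_injective ?_
    obtain ⟨c, hc⟩ := distTriang_desc₃ hT (ι.map h) (by rw [← ι.map_comp, hh, ι.map_zero])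
    have hc0 : c = 0 := shift_hom_obj_eq_zero hvan (by omega) c
    rw [hc, hc0, comp_zero, ι.map_zero]
  refine ⟨w, { exact := ?_, mono_f := hf, epi_g := hg }⟩
  refine ShortComplex.exact_of_f_is_kernel _ (KernelFork.IsLimit.ofι' f w fun {Z} h hh => ?_)
  have := distTriang_lift₂ hT (ι.map h) (by rw [← ι.map_comp, hh, ι.map_zero])
  exact ⟨ι.preimage this.choose, ι.map_injective (by
    rw [ι.map_comp, ι.map_preimage]
    exact this.choose_spec.symm)⟩

/-- Every degree one morphism between objects of the heart is the class of an extension. -/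
lemma exists_extension [HasFiniteBiproducts T] [ι.Additive] [ι.Full] [ι.Faithful]
    (hmodel : IsBoundedDerivedModel ι)
    (hvan : ∀ (A B : C) (n : ℤ), (n < 0 ∨ 2 ≤ n) → ∀ f : ι.obj A ⟶ (ι.obj B)⟦n⟧, f = 0)
    {A B : C} (δ : ι.obj B ⟶ (ι.obj A)⟦(1 : ℤ)⟧) :
    ∃ (E : C) (f : A ⟶ E) (g : E ⟶ B) (w : f ≫ g = 0),
      (ShortComplex.mk f g w).ShortExact ∧ Triangle.mk (ι.map f) (ι.map g) δ ∈ distTriang T := by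
  obtain ⟨E, f, g, hT⟩ := distinguished_cocone_triangle₂ δ
  obtain ⟨E', ⟨e⟩⟩ := exists_iso_of_extension hmodel hvan hT
  have hT' := distTriang_of_iso₂ hT e
  rw [← ι.map_preimage (f ≫ e.inv), ← ι.map_preimage (e.hom ≫ g)] at hT'
  obtain ⟨w, hw⟩ := shortExact_of_distTriang hvan hT'
  exact ⟨E', _, _, w, hw, hT'⟩

lemma hom_shift_one_eq_zero_of_projective [HasFiniteBiproducts T] [ι.Additive] [ι.Full]
    [ι.Faithful] (hmodel : IsBoundedDerivedModel ι)
    (hvan : ∀ (A B : C) (n : ℤ), (n < 0 ∨ 2 ≤ n) → ∀ f : ι.obj A ⟶ (ι.obj B)⟦n⟧, f = 0)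
    {P : C} (hP : Projective P) {B : C} (δ : ι.obj P ⟶ (ι.obj B)⟦(1 : ℤ)⟧) : δ = 0 := by
  obtain ⟨E, f, g, w, hS, hT⟩ := exists_extension hmodel hvan δ
  have : Epi g := hS.epi_g
  have h0 : ι.map g ≫ δ = 0 := distTriang_comp_zero₂₃ hT
  have h1 : ι.map (Projective.factorThru (𝟙 P) g) ≫ ι.map g = 𝟙 _ := by
    rw [← ι.map_comp, Projective.factorThru_comp, ι.map_id]
  rw [← Category.id_comp δ, ← h1, Category.assoc, h0, comp_zero]

lemma projective_of_hom_shift_one_eq_zero [HasFiniteBiproducts T] [ι.Full] [ι.Faithful]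
    (hmodel : IsBoundedDerivedModel ι) {P : C}
    (hP : ∀ (B : C) (δ : ι.obj P ⟶ (ι.obj B)⟦(1 : ℤ)⟧), δ = 0) : Projective P := by
  refine ⟨fun {E X} f e he => ?_⟩
  obtain ⟨δ, hT⟩ := exists_distTriang hmodel (w := kernel.condition e)
    { exact := ShortComplex.exact_of_f_is_kernel _ (kernelIsKernel e) }
  obtain ⟨g, hg⟩ := distTriang_lift₃ hT (ι.map f) (hP _ _)
  exact ⟨ι.preimage g, ι.map_injective (by rw [ι.map_comp, ι.map_preimage]; exact hg.symm)⟩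

/-- In a hereditary category, subobjects of projectives are projective. -/
lemma projective_of_mono [HasFiniteBiproducts T] [ι.Additive] [ι.Full] [ι.Faithful]
    (hmodel : IsBoundedDerivedModel ι)
    (hvan : ∀ (A B : C) (n : ℤ), (n < 0 ∨ 2 ≤ n) → ∀ f : ι.obj A ⟶ (ι.obj B)⟦n⟧, f = 0)
    {P' P : C} (hP : Projective P) (f : P' ⟶ P) [Mono f] : Projective P' := by
  refine projective_of_hom_shift_one_eq_zero hmodel fun B δ => ?_
  obtain ⟨δ', hT⟩ := exists_distTriang hmodel (w := cokernel.condition f)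
    { exact := ShortComplex.exact_of_g_is_cokernel _ (cokernelIsCokernel f) }
  obtain ⟨g, hg⟩ := distTriang_desc₁ hT δ (shift_hom_eq_zero hvan (by omega))
  have hg0 : g = 0 := hom_shift_one_eq_zero_of_projective hmodel hvan hP g
  rw [hg, hg0, comp_zero]

lemma Indec.projective_of_hom_ne_zero [HasFiniteBiproducts T] [ι.Additive] [ι.Full] [ι.Faithful]
    (hmodel : IsBoundedDerivedModel ι)
    (hvan : ∀ (A B : C) (n : ℤ), (n < 0 ∨ 2 ≤ n) → ∀ f : ι.obj A ⟶ (ι.obj B)⟦n⟧, f = 0)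
    {W P : C} (hW : Indec W) (hP : Projective P) {f : W ⟶ P} (hf : f ≠ 0) : Projective W := by
  have hI : Projective (Limits.image f) := projective_of_mono hmodel hvan hP (image.ι f)
  have hs : Projective.factorThru (𝟙 _) (factorThruImage f) ≫ factorThruImage f = 𝟙 _ :=
    Projective.factorThru_comp _ _
  have := (hW.isIso_of_comp_eq_id (fun hz => hf ?_) hs).2
  · exact Projective.of_iso (asIso (factorThruImage f)).symm hI
  · rw [← image.fac f, hz.eq_of_src (image.ι f) 0, comp_zero]

end Heart

section Serre

variable {k : Type} [Field k] {C T : Type} [Category C] [Abelian C] [Category T] [Preadditive T]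
  [Linear k T] [HasZeroObject T] [HasFiniteBiproducts T] [HasShift T ℤ]
  [∀ n : ℤ, (CategoryTheory.shiftFunctor T n).Additive] [Pretriangulated T]
  {ι : C ⥤ T} [ι.Additive] [ι.Full] [ι.Faithful]

/-- For `X` indecomposable and not projective, the Serre functor sends `X` to an object of the
heart placed in degree `-1`. -/
lemma exists_serre_iso_shift (hmodel : IsBoundedDerivedModel ι)
    (hvan : ∀ (A B : C) (n : ℤ), (n < 0 ∨ 2 ≤ n) → ∀ f : ι.obj A ⟶ (ι.obj B)⟦n⟧, f = 0)
    (S : RightSerreFunctor k T) (hS : S.F.IsEquivalence) {X : C} (hX : Indec X)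
    (hXP : ¬ Projective X) :
    ∃ A : C, Indec A ∧ Nonempty (S.F.obj (ι.obj X) ≅ (ι.obj A)⟦(1 : ℤ)⟧) := by
  have := S.additive
  have hιX : Indec (ι.obj X) := (indec_map_iff ι X).2 hX
  have hY : Indec (S.F.obj (ι.obj X)) := (indec_map_iff S.F _).2 hιX
  have hne : ∀ {Z : T} (h : ι.obj X ⟶ Z), h ≠ 0 → ∃ g : Z ⟶ S.F.obj (ι.obj X), g ≠ 0 := by
    intro Z h hh
    by_contra! hg
    refine hh ((S.η _ _).injective (LinearMap.ext fun g => ?_))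
    rw [hg g, map_zero, map_zero]
  obtain ⟨n, obj, deg, ⟨e⟩⟩ := hmodel.2.2 (S.F.obj (ι.obj X))
  obtain ⟨i, ⟨e⟩⟩ := hY.exists_iso_of_biproduct e
  obtain ⟨w, hw⟩ := hne (𝟙 (ι.obj X)) (fun h => hιX.1 ((IsZero.iff_id_eq_zero _).2 h))
  have h1 : ¬ (deg i < 0 ∨ 2 ≤ deg i) := fun h => hw <| by
    rw [← cancel_mono e.hom, zero_comp]
    exact hvan _ _ _ h _
  have h2 : ¬ (deg i < 1) := fun h => hXP <|
    projective_of_hom_shift_one_eq_zero hmodel fun B δ => by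
      by_contra hδ
      obtain ⟨g, hg⟩ := hne δ hδ
      refine hg ?_
      rw [← cancel_mono e.hom, zero_comp]
      exact shift_hom_eq_zero hvan (Or.inl h) _
  have h3 : deg i = 1 := by omega
  rw [h3] at e
  exact ⟨obj i, (indec_map_iff ι _).1
    ((indec_map_iff (CategoryTheory.shiftFunctor T (1 : ℤ)) _).1 (hY.of_iso e)), ⟨e⟩⟩

/-- Existence of almost split sequences ending at a nonprojective indecomposable object. -/
lemma exists_almostSplit (hmodel : IsBoundedDerivedModel ι)
    (hvan : ∀ (A B : C) (n : ℤ), (n < 0 ∨ 2 ≤ n) → ∀ f : ι.obj A ⟶ (ι.obj B)⟦n⟧, f = 0)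
    (hfin : ∀ X Y : T, FiniteDimensional k (X ⟶ Y))
    (S : RightSerreFunctor k T) (hS : S.F.IsEquivalence) {X : C} (hX : Indec X)
    (hXP : ¬ Projective X) :
    ∃ Q : ShortComplex C, IsAlmostSplitSeq Q ∧ Nonempty (Q.X₃ ≅ X) ∧
      Nonempty (S.F.obj (ι.obj X) ≅ (ι.obj Q.X₁)⟦(1 : ℤ)⟧) := by
  obtain ⟨A, hA, ⟨e⟩⟩ := exists_serre_iso_shift hmodel hvan S hS hX hXP
  obtain ⟨φ, hφ1, hφ⟩ := ((indec_map_iff ι X).2 hX).exists_dual_vanishing_on_nonIso k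
  obtain ⟨w, hw⟩ : ∃ w : ι.obj X ⟶ S.F.obj (ι.obj X), ∀ h, S.η _ _ h w = φ h := by
    obtain ⟨w, hw⟩ := (Module.evalEquiv k (ι.obj X ⟶ S.F.obj (ι.obj X))).surjective
      (φ ∘ₗ (S.η (ι.obj X) (ι.obj X)).symm.toLinearMap)
    refine ⟨w, fun h => ?_⟩
    simpa using LinearMap.congr_fun hw (S.η _ _ h)
  obtain ⟨E, f, g, hfg, hQ, hT⟩ := exists_extension hmodel hvan (w ≫ e.hom)
  refine ⟨ShortComplex.mk f g hfg, ⟨hQ, ?_, hA, hX, ?_⟩, ⟨Iso.refl _⟩, ⟨e⟩⟩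
  · rintro ⟨s, hs : s ≫ g = 𝟙 X⟩
    have h0 : w = 0 := by
      rw [← cancel_mono e.hom, zero_comp, ← Category.id_comp (w ≫ e.hom), ← ι.map_id, ← hs,
        ι.map_comp, Category.assoc, distTriang_comp_zero₂₃ hT, comp_zero]
    exact hφ1 (by rw [← hw, h0, map_zero])
  · intro Z (t : Z ⟶ X) ht
    have h0 : ι.map t ≫ w = 0 := by
      refine (Module.forall_dual_apply_eq_zero_iff k _).1 fun ψ => ?_
      obtain ⟨h, rfl⟩ := (S.η _ _).surjective ψ
      rw [← S.nat_right, hw]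
      refine hφ _ fun hi => ht ⟨⟨⟨ι.preimage (inv (h ≫ ι.map t) ≫ h), ι.map_injective ?_⟩⟩⟩
      simp
    obtain ⟨c, hc⟩ := distTriang_lift₃ hT (ι.map t) (by rw [reassoc_of% h0, zero_comp])
    exact ⟨ι.preimage c, ι.map_injective (by simp [hc])⟩

lemma TauInvStep.exists_hom_ne_zero (hmodel : IsBoundedDerivedModel ι)
    (hvan : ∀ (A B : C) (n : ℤ), (n < 0 ∨ 2 ≤ n) → ∀ f : ι.obj A ⟶ (ι.obj B)⟦n⟧, f = 0)
    (hfin : ∀ X Y : T, FiniteDimensional k (X ⟶ Y))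
    (S : RightSerreFunctor k T) (hS : S.F.IsEquivalence)
    (hloc : ∀ X : C, Indec X → ∀ f : X ⟶ X, IsIso f ∨ ∃ n : ℕ, (End.of f) ^ n = 0)
    {A Y X : C} (hAY : TauInvStep A Y) (hX : Indec X) (hXP : ¬ Projective X) {f : X ⟶ Y}
    (hf : f ≠ 0) : ∃ A' : C, Indec A' ∧ TauInvStep A' X ∧ ∃ g : A' ⟶ A, g ≠ 0 := by
  obtain ⟨Q, hQ, ⟨eA⟩, ⟨eY⟩⟩ := hAY
  have := hQ.1.epi_g
  have hQP : ¬ Projective Q.X₃ := fun _ => hQ.2.1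
    ⟨Projective.factorThru (𝟙 _) Q.g, Projective.factorThru_comp _ _⟩
  obtain ⟨Q', hQ', ⟨e'⟩, ⟨d'⟩⟩ := exists_almostSplit hmodel hvan hfin S hS hQ.2.2.2.1 hQP
  obtain ⟨R, hR, ⟨e⟩, ⟨d⟩⟩ := exists_almostSplit hmodel hvan hfin S hS hX hXP
  obtain ⟨a⟩ := hQ'.iso_left hloc hQ e'
  refine ⟨R.X₁, hR.2.2.1, ⟨R, hR, ⟨Iso.refl _⟩, ⟨e⟩⟩, ?_⟩
  have := S.additive
  obtain ⟨g', hg'⟩ := (CategoryTheory.shiftFunctor T (1 : ℤ)).map_surjective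
    (d.inv ≫ S.F.map (ι.map (f ≫ eY.inv)) ≫ d'.hom)
  obtain ⟨g, rfl⟩ := ι.map_surjective g'
  refine ⟨g ≫ a.hom ≫ eA.hom, fun h0 => hf ?_⟩
  have hg : g = 0 := by simpa using h0 =≫ (eA.inv ≫ a.inv)
  rw [hg, ι.map_zero, Functor.map_zero] at hg'
  have h1 : S.F.map (ι.map (f ≫ eY.inv)) = 0 := by simpa using (d.hom ≫= hg' =≫ d'.inv).symm
  rw [Functor.map_eq_zero_iff, Functor.map_eq_zero_iff] at h1
  simpa using h1 =≫ eY.hom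

/-- An indecomposable object with a nonzero map to some `τ^{-a} P` is of this form. -/
lemma exists_tauInvChain_of_hom_ne_zero (hmodel : IsBoundedDerivedModel ι)
    (hvan : ∀ (A B : C) (n : ℤ), (n < 0 ∨ 2 ≤ n) → ∀ f : ι.obj A ⟶ (ι.obj B)⟦n⟧, f = 0)
    (hfin : ∀ X Y : T, FiniteDimensional k (X ⟶ Y))
    (S : RightSerreFunctor k T) (hS : S.F.IsEquivalence)
    (hloc : ∀ X : C, Indec X → ∀ f : X ⟶ X, IsIso f ∨ ∃ n : ℕ, (End.of f) ^ n = 0)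
    {P Y X : C} {a : ℕ} (hP : Projective P) (hY : TauInvChain P Y a) (hX : Indec X) {f : X ⟶ Y}
    (hf : f ≠ 0) : ∃ (P' : C) (b : ℕ), Projective P' ∧ Indec P' ∧ TauInvChain P' X b := by
  induction a generalizing X Y with
  | zero =>
    obtain ⟨ch, ⟨e₀⟩, ⟨e⟩, -⟩ := hY
    refine ⟨X, 0, hX.projective_of_hom_ne_zero hmodel hvan hP (f := f ≫ e.inv ≫ e₀.hom)
      (fun h => hf ?_), hX, fun _ => X, ⟨Iso.refl _⟩, ⟨Iso.refl _⟩, by simp⟩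
    simpa using h =≫ (e₀.inv ≫ e.hom)
  | succ a ih =>
    by_cases hXP : Projective X
    · exact ⟨X, 0, hXP, hX, fun _ => X, ⟨Iso.refl _⟩, ⟨Iso.refl _⟩, by simp⟩
    obtain ⟨ch, e₀, ⟨e⟩, hch⟩ := hY
    obtain ⟨A', hA', hstep, g, hg⟩ := ((hch a (by omega)).of_iso (Iso.refl _) e).exists_hom_ne_zero
      hmodel hvan hfin S hS hloc hX hXP hf
    obtain ⟨P', b, hP', hP'i, hb⟩ :=
      ih ⟨ch, e₀, ⟨Iso.refl _⟩, fun i hi => hch i (by omega)⟩ hA' hg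
    exact ⟨P', b + 1, hP', hP'i, hb.succ hstep⟩

end Serre

section Closure

variable {C : Type} [Category C] [Abelian C]

/-- An object is preprojective as soon as each of its indecomposable subobjects maps nontrivially
to a preprojective object. -/
lemma preprojective_of_forall_mono
    (hdec : ∀ X : C, ∃ (n : ℕ) (f : Fin n → C), (∀ i, Indec (f i)) ∧ Nonempty (X ≅ ⨁ f))
    (hpre : ∀ (P X Y : C) (a : ℕ) (f : X ⟶ Y), Projective P → TauInvChain P Y a → Indec X →
      f ≠ 0 → ∃ (P' : C) (b : ℕ), Projective P' ∧ Indec P' ∧ TauInvChain P' X b)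
    {X : C} (hX : ∀ (W : C) (i : W ⟶ X), Indec W → Mono i →
      ∃ (R : C) (f : W ⟶ R), Preprojective R ∧ f ≠ 0) : Preprojective X := by
  obtain ⟨n, obj, hobj, ⟨e⟩⟩ := hdec X
  refine ⟨n, obj, fun i => ?_, ⟨e⟩⟩
  obtain ⟨R, f, ⟨m, R', hR', ⟨eR⟩⟩, hf⟩ :=
    hX (obj i) (biproduct.ι obj i ≫ e.inv) (hobj i) inferInstance
  obtain ⟨j, hj⟩ : ∃ j, f ≫ eR.hom ≫ biproduct.π R' j ≠ 0 := by
    by_contra! h0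
    refine hf ?_
    rw [← cancel_mono eR.hom, zero_comp]
    exact biproduct.hom_ext _ _ fun j => by simp [h0 j]
  obtain ⟨P, a, hP, -, ha⟩ := hR' j
  exact hpre P _ _ a _ hP ha (hobj i) hj

lemma IsQuotientOfPreprojective.of_epi {X Y : C} (h : IsQuotientOfPreprojective X) (p : X ⟶ Y)
    [Epi p] : IsQuotientOfPreprojective Y := by
  obtain ⟨R, q, hR, hq⟩ := h
  exact ⟨R, q ≫ p, hR, epi_comp q p⟩

end Closure

section FullyFaithful

variable {C T : Type} [Category C] [Abelian C] [Category T] [Preadditive T]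

lemma Indec.isIso_or_nilpotent_of_fullyFaithful (k : Type) [Field k] [Linear k T] (ι : C ⥤ T)
    [ι.Additive] [ι.Full] [ι.Faithful] (hfin : ∀ X Y : T, FiniteDimensional k (X ⟶ Y)) {X : C}
    (hX : Indec X) (f : X ⟶ X) : IsIso f ∨ ∃ n : ℕ, (End.of f) ^ n = 0 := by
  let := inducedLinear k ι
  have := finiteDimensional_inducedLinear k ι hfin X X
  exact hX.isIso_or_nilpotent k f

lemma exists_indec_decomposition_of_fullyFaithful (k : Type) [Field k] [Linear k T] (ι : C ⥤ T)
    [ι.Additive] [ι.Full] [ι.Faithful] (hfin : ∀ X Y : T, FiniteDimensional k (X ⟶ Y)) (X : C) :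
    ∃ (n : ℕ) (f : Fin n → C), (∀ i, Indec (f i)) ∧ Nonempty (X ≅ ⨁ f) := by
  let := inducedLinear k ι
  exact exists_indec_decomposition k (finiteDimensional_inducedLinear k ι hfin) X

end FullyFaithful

section Extension

variable {C T : Type} [Category C] [Abelian C] [Category T] [Preadditive T] [HasZeroObject T]
  [HasFiniteBiproducts T] [HasShift T ℤ]
  [∀ n : ℤ, (CategoryTheory.shiftFunctor T n).Additive] [Pretriangulated T]
  {ι : C ⥤ T}

/-- In a hereditary category, `Ext¹(X, -)` preserves epimorphisms. -/
lemma exists_lift_shift_one (hmodel : IsBoundedDerivedModel ι)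
    (hvan : ∀ (A B : C) (n : ℤ), (n < 0 ∨ 2 ≤ n) → ∀ f : ι.obj A ⟶ (ι.obj B)⟦n⟧, f = 0)
    {R A X : C} (p : R ⟶ A) [Epi p] (δ : ι.obj X ⟶ (ι.obj A)⟦(1 : ℤ)⟧) :
    ∃ δ' : ι.obj X ⟶ (ι.obj R)⟦(1 : ℤ)⟧, δ' ≫ (ι.map p)⟦(1 : ℤ)⟧' = δ := by
  obtain ⟨d, hT⟩ := exists_distTriang hmodel (w := kernel.condition p)
    { exact := ShortComplex.exact_of_f_is_kernel _ (kernelIsKernel p) }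
  let e : (ι.obj (kernel p))⟦(2 : ℤ)⟧ ≅ (ι.obj (kernel p))⟦(1 : ℤ)⟧⟦(1 : ℤ)⟧ :=
    (shiftFunctorAdd' T 1 1 2 rfl).app (ι.obj (kernel p))
  have h0 : δ ≫ d⟦(1 : ℤ)⟧' = 0 := by
    rw [← cancel_mono e.inv, zero_comp]
    exact hvan _ _ 2 (Or.inr le_rfl) _
  obtain ⟨c, hc⟩ : ∃ c : ι.obj X ⟶ (ι.obj R)⟦(1 : ℤ)⟧, δ = c ≫ (-(ι.map p)⟦(1 : ℤ)⟧') :=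
    Triangle.coyoneda_exact₁ _ (rot_of_distTriang _ (rot_of_distTriang _ hT)) δ h0
  exact ⟨-c, by rw [hc, Preadditive.neg_comp, Preadditive.comp_neg]⟩

/-- An extension of quotients of `R` and `R'` is a quotient of an extension of `R'` by `R`. -/
lemma exists_epi_from_extension [ι.Additive] [ι.Full] [ι.Faithful]
    (hmodel : IsBoundedDerivedModel ι)
    (hvan : ∀ (A B : C) (n : ℤ), (n < 0 ∨ 2 ≤ n) → ∀ f : ι.obj A ⟶ (ι.obj B)⟦n⟧, f = 0)
    {E : ShortComplex C} (hE : E.ShortExact) {R R' : C} (p : R ⟶ E.X₁) (q : R' ⟶ E.X₃)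
    [Epi p] [Epi q] :
    ∃ (E' : ShortComplex C) (b : E'.X₂ ⟶ E.X₂), E'.ShortExact ∧ E'.X₁ = R ∧ E'.X₃ = R' ∧
      Epi b := by
  obtain ⟨δ, hT⟩ := hmodel.2.1 E hE
  obtain ⟨δ', hδ'⟩ := exists_lift_shift_one hmodel hvan p (ι.map q ≫ δ)
  obtain ⟨E', f, g, w, hE', hT'⟩ := exists_extension hmodel hvan δ'
  obtain ⟨b, hb₁, hb₂⟩ := distTriang_morphism₂ hT' hT _ _ hδ'
  obtain ⟨b, rfl⟩ := ι.map_surjective b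
  simp only [← ι.map_comp] at hb₁ hb₂
  let φ : ShortComplex.mk f g w ⟶ E :=
    { τ₁ := p
      τ₂ := b
      τ₃ := q
      comm₁₂ := (ι.map_injective hb₁).symm
      comm₂₃ := (ι.map_injective hb₂).symm }
  exact ⟨_, b, hE', rfl, rfl,
    ShortComplex.epi_of_epi_of_epi_of_epi φ hE.exact hE'.epi_g ‹Epi p› ‹Epi q›⟩

end Extension

lemma Indec.ne_zero_of_mono {A : Type} [Category A] [Preadditive A] {W X : A} (hW : Indec W)
    (i : W ⟶ X) [Mono i] : i ≠ 0 := by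
  rintro rfl
  refine hW.1 ((IsZero.iff_id_eq_zero W).2 ?_)
  rw [← cancel_mono (0 : W ⟶ X), comp_zero, comp_zero]

/-- Let `C` be an Ext-finite hereditary abelian `k`-category with a Serre functor
(modelled on `T ≃ D^b(C)`).  The full subcategory `𝒬` of quotients of preprojective
objects is closed under subobjects, quotients and extensions. -/
theorem quotients_of_preprojectives_closed (k : Type) [Field k]
    (C : Type) [Category C] [Abelian C] [Linear k C]
    (T : Type) [Category T] [Preadditive T] [Linear k T] [HasZeroObject T]
    [HasFiniteBiproducts T] [HasShift T ℤ]
    [∀ n : ℤ, (CategoryTheory.shiftFunctor T n).Additive] [Pretriangulated T]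
    (ι : C ⥤ T) [ι.Additive] [ι.Full] [ι.Faithful]
    (hmodel : IsBoundedDerivedModel ι)
    (hfin : ∀ X Y : T, FiniteDimensional k (X ⟶ Y))
    (hher : ∀ (A B : C) (n : ℤ), 2 ≤ n → ∀ f : ι.obj A ⟶ (ι.obj B)⟦n⟧, f = 0)
    (S : RightSerreFunctor k T) (hS : S.F.IsEquivalence) :
    (∀ (X Y : C) (f : X ⟶ Y), Mono f →
      IsQuotientOfPreprojective Y → IsQuotientOfPreprojective X) ∧
    (∀ (X Y : C) (p : X ⟶ Y), Epi p →
      IsQuotientOfPreprojective X → IsQuotientOfPreprojective Y) ∧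
    (∀ E : ShortComplex C, E.ShortExact →
      IsQuotientOfPreprojective E.X₁ → IsQuotientOfPreprojective E.X₃ →
      IsQuotientOfPreprojective E.X₂) := by
  have hvan : ∀ (A B : C) (n : ℤ), (n < 0 ∨ 2 ≤ n) → ∀ f : ι.obj A ⟶ (ι.obj B)⟦n⟧, f = 0 :=
    fun A B n h => h.elim (hmodel.1 A B n) (hher A B n)
  have hdec := exists_indec_decomposition_of_fullyFaithful k ι hfin
  have hpre : ∀ (P X Y : C) (a : ℕ) (f : X ⟶ Y), Projective P → TauInvChain P Y a → Indec X →
      f ≠ 0 → ∃ (P' : C) (b : ℕ), Projective P' ∧ Indec P' ∧ TauInvChain P' X b :=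
    fun _ _ _ _ _ hP hY hX hf => exists_tauInvChain_of_hom_ne_zero hmodel hvan hfin S hS
      (fun _ hX => hX.isIso_or_nilpotent_of_fullyFaithful k ι hfin) hP hY hX hf
  refine ⟨?_, fun X Y p _ hX => hX.of_epi p, ?_⟩
  · rintro X Y f _ ⟨R, p, hR, _⟩
    exact ⟨pullback f p, pullback.fst f p, preprojective_of_forall_mono hdec hpre
      fun W i hW _ => ⟨R, i ≫ pullback.snd f p, hR, hW.ne_zero_of_mono _⟩, inferInstance⟩
  · rintro E hE ⟨R, p, hR, _⟩ ⟨R', q, hR', _⟩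
    obtain ⟨E', b, hE', rfl, rfl, hb⟩ := exists_epi_from_extension hmodel hvan hE p q
    refine ⟨E'.X₂, b, preprojective_of_forall_mono hdec hpre fun W i hW _ => ?_, hb⟩
    by_cases hi : i ≫ E'.g = 0
    · have := hE'.mono_f
      refine ⟨E'.X₁, hE'.exact.lift i hi, hR, fun h0 => hW.ne_zero_of_mono i ?_⟩
      rw [← hE'.exact.lift_f i hi, h0, zero_comp]
    · exact ⟨E'.X₃, i ≫ E'.g, hR', hi⟩
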